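/- arXiv:2003.04475 — 2 statements merged into one kernel-verified Lean document; each statement's English description precedes it below -/
import Mathlib

section
/- Let g : 𝒳 → 𝒵 be a measurable feature map and h : 𝒵 → 𝒴 measurable, with Ŷ = h(g(X)). Let γ := min_{y∈𝒴} D_T(Y = y) > 0 and w_M := max_{y∈𝒴} w_y. Then max_{y∈𝒴} d_TV(D_S(Z | Y = y), D_T(Z | Y = y)) ≤ (w_M·ε_S(Ŷ) + ε_T(Ŷ) + √(8·D_JS(D_S^w(Z) ‖ D_T(Z)))) / γ, where d_TV denotes the total variation distance between the conditional feature distributions. -/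
open MeasureTheory Real
open scoped ENNReal

/-- Kullback–Leibler divergence (real-valued, via the Radon–Nikodym derivative). -/
noncomputable def klDiv {Ω : Type*} [MeasurableSpace Ω] (μ ν : Measure Ω) : ℝ :=
  ∫ x, Real.log ((μ.rnDeriv ν) x).toReal ∂μ

/-- Jensen–Shannon divergence: `(1/2)·KL(μ‖M) + (1/2)·KL(ν‖M)` with `M = (μ+ν)/2`. -/
noncomputable def jsDiv {Ω : Type*} [MeasurableSpace Ω] (μ ν : Measure Ω) : ℝ :=
  (1 / 2) * klDiv μ ((2 : ℝ≥0∞)⁻¹ • (μ + ν)) + (1 / 2) * klDiv ν ((2 : ℝ≥0∞)⁻¹ • (μ + ν))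

/-- Total variation distance: supremum over measurable sets of the absolute difference. -/
noncomputable def tvDist {Ω : Type*} [MeasurableSpace Ω] (μ ν : Measure Ω) : ℝ :=
  ⨆ E : {s : Set Ω // MeasurableSet s}, |(μ E.1).toReal - (ν E.1).toReal|

/-- Error of a classifier `f : 𝒳 → Fin k` under a domain `D` on `𝒳 × Fin k`. -/
noncomputable def err {𝒳 : Type*} [MeasurableSpace 𝒳] {k : ℕ}
    (D : Measure (𝒳 × Fin k)) (f : 𝒳 → Fin k) : ℝ :=
  (D {p | f p.1 ≠ p.2}).toReal

/-- Importance weights `w_y = D_T(Y = y) / D_S(Y = y)`. -/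
noncomputable def iw {𝒳 : Type*} [MeasurableSpace 𝒳] {k : ℕ}
    (DS DT : Measure (𝒳 × Fin k)) (y : Fin k) : ℝ :=
  (DT {p | p.2 = y}).toReal / (DS {p | p.2 = y}).toReal

/-- The feature distribution: pushforward of the input marginal by `g`. -/
noncomputable def featMeasure {𝒳 Z : Type*} [MeasurableSpace 𝒳] [MeasurableSpace Z] {k : ℕ}
    (D : Measure (𝒳 × Fin k)) (g : 𝒳 → Z) : Measure Z :=
  D.map fun p => g p.1

/-- The conditional feature distribution `D(Z ∈ · | Y = y)`. -/
noncomputable def condFeat {𝒳 Z : Type*} [MeasurableSpace 𝒳] [MeasurableSpace Z] {k : ℕ}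
    (D : Measure (𝒳 × Fin k)) (g : 𝒳 → Z) (y : Fin k) : Measure Z :=
  (D {p | p.2 = y})⁻¹ • ((D.restrict {p | p.2 = y}).map fun p => g p.1)

/-- The `w`-reweighted source feature distribution `D_S^w(Z ∈ E) = Σ_y w_y·D_S(Z ∈ E, Y = y)`. -/
noncomputable def reweightedFeat {𝒳 Z : Type*} [MeasurableSpace 𝒳] [MeasurableSpace Z] {k : ℕ}
    (DS DT : Measure (𝒳 × Fin k)) (g : 𝒳 → Z) : Measure Z :=
  ∑ y : Fin k,
    ENNReal.ofReal (iw DS DT y) • ((DS.restrict {p | p.2 = y}).map fun p => g p.1)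

theorem sub_one_add_sq_div_eight_le_mul_log {u : ℝ} (h0 : 0 ≤ u) (h2 : u ≤ 2) :
    (u - 1) + (u - 1) ^ 2 / 8 ≤ u * Real.log u := by
  rcases h0.eq_or_lt with rfl | hpos
  · norm_num
  obtain ⟨s, hs, rfl⟩ : ∃ s : ℝ, 0 < s ∧ u = s ^ 2 :=
    ⟨√u, Real.sqrt_pos.2 hpos, (Real.sq_sqrt h0).symm⟩
  have hlog : s ^ 2 * (2 * (1 - s⁻¹)) ≤ s ^ 2 * Real.log (s ^ 2) := by
    rw [Real.log_pow]
    have := Real.one_sub_inv_le_log_of_pos hs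
    push_cast
    gcongr
  have heq : s ^ 2 * (2 * (1 - s⁻¹)) = 2 * s ^ 2 - 2 * s := by
    field_simp
  have hfac : (1 + s) ^ 2 ≤ 8 := by nlinarith [sq_nonneg (1 - s)]
  have := mul_le_mul_of_nonneg_left hfac (sq_nonneg (s - 1))
  nlinarith

/-- A Pinsker-type inequality for measures with density at most `2`. -/
theorem sq_measureReal_sub_le_klDiv {Ω : Type*} [MeasurableSpace Ω] (μ ν : Measure Ω)
    [IsProbabilityMeasure μ] [IsProbabilityMeasure ν] (hμν : μ ≤ (2 : ℝ≥0∞) • ν)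
    {B : Set Ω} (hB : MeasurableSet B) :
    (μ.real B - ν.real B) ^ 2 / 2 ≤ klDiv μ ν := by
  have hac : μ ≪ ν :=
    (Measure.absolutelyContinuous_of_le hμν).trans Measure.smul_absolutelyContinuous
  set r : Ω → ℝ := fun x => ((μ.rnDeriv ν) x).toReal with hr
  set δ := μ.real B - ν.real B with hδ
  have hr0 : ∀ x, 0 ≤ r x := fun x => ENNReal.toReal_nonneg
  have hrm : Measurable r := (Measure.measurable_rnDeriv μ ν).ennreal_toReal
  have hr2 : ∀ᵐ x ∂ν, r x ≤ 2 := by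
    have : μ.rnDeriv ν ≤ᵐ[ν] fun _ => (2 : ℝ≥0∞) := by
      refine ae_le_of_forall_setLIntegral_le_of_sigmaFinite (Measure.measurable_rnDeriv μ ν)
        fun s _ _ => ?_
      rw [Measure.setLIntegral_rnDeriv hac, setLIntegral_const]
      exact hμν s
    filter_upwards [this] with x hx
    exact ENNReal.toReal_le_of_le_ofReal (by norm_num) (by simpa using hx)
  have hri : Integrable r ν := Measure.integrable_toReal_rnDeriv
  have hr1 : Integrable (fun x => r x - 1) ν := hri.sub (integrable_const 1)
  have hBi : Integrable (B.indicator fun x => r x - 1) ν := hr1.indicator hB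
  have hint1 : ∫ x, (r x - 1) ∂ν = 0 := by
    rw [integral_sub hri (integrable_const 1), hr, Measure.integral_toReal_rnDeriv hac]
    simp
  have hintB : ∫ x, B.indicator (fun x => r x - 1) x ∂ν = δ := by
    rw [integral_indicator hB, integral_sub hri.integrableOn (integrable_const 1), hr,
      Measure.setIntegral_toReal_rnDeriv hac]
    simp [hδ]
  have hpt : ∀ᵐ x ∂ν, (r x - 1) + (δ * B.indicator (fun x => r x - 1) x
      - δ / 2 * (r x - 1) - δ ^ 2 / 2) ≤ r x * Real.log (r x) := by
    filter_upwards [hr2] with x hx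
    have := sub_one_add_sq_div_eight_le_mul_log (hr0 x) hx
    by_cases hxB : x ∈ B
    · rw [Set.indicator_of_mem hxB]
      nlinarith [sq_nonneg (r x - 1 - 2 * δ)]
    · rw [Set.indicator_of_notMem hxB]
      nlinarith [sq_nonneg (r x - 1 + 2 * δ)]
  have hlogi : Integrable (fun x => r x * Real.log (r x)) ν := by
    refine Integrable.of_bound (hrm.mul hrm.log).aestronglyMeasurable 4 ?_
    filter_upwards [hr2] with x hx
    have h1 := sub_one_add_sq_div_eight_le_mul_log (hr0 x) hx
    have h2 : r x * Real.log (r x) ≤ r x * (r x - 1) := by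
      rcases (hr0 x).eq_or_lt with h | h
      · simp [← h]
      · exact mul_le_mul_of_nonneg_left (Real.log_le_sub_one_of_pos h) h.le
    rw [Real.norm_eq_abs, abs_le]
    constructor <;> nlinarith [hr0 x, sq_nonneg (r x - 1)]
  have hkl : klDiv μ ν = ∫ x, r x * Real.log (r x) ∂ν := by
    rw [klDiv]
    exact (integral_rnDeriv_smul (f := fun x => Real.log (r x)) hac).symm
  have hi2 : Integrable (fun x => δ * B.indicator (fun x => r x - 1) x - δ / 2 * (r x - 1)) ν :=
    (hBi.const_mul δ).sub (hr1.const_mul (δ / 2))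
  have hi3 : Integrable (fun x => δ * B.indicator (fun x => r x - 1) x - δ / 2 * (r x - 1)
      - δ ^ 2 / 2) ν := hi2.sub (integrable_const (δ ^ 2 / 2))
  have hmono := integral_mono_ae (hr1.add hi3) hlogi hpt
  have hval : ∫ x, ((r x - 1) + (δ * B.indicator (fun x => r x - 1) x
      - δ / 2 * (r x - 1) - δ ^ 2 / 2)) ∂ν = δ ^ 2 / 2 := by
    rw [integral_add hr1 hi3, hint1, integral_sub hi2 (integrable_const _),
      integral_sub (hBi.const_mul δ) (hr1.const_mul (δ / 2)), integral_const_mul,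
      integral_const_mul, hint1, hintB]
    simp
    ring
  rw [hkl]
  exact hval.symm.le.trans hmono

theorem abs_measureReal_sub_le_sqrt_jsDiv {Ω : Type*} [MeasurableSpace Ω] (μ ν : Measure Ω)
    [IsProbabilityMeasure μ] [IsProbabilityMeasure ν] {B : Set Ω} (hB : MeasurableSet B) :
    |μ.real B - ν.real B| ≤ √(8 * jsDiv μ ν) := by
  set m := (2 : ℝ≥0∞)⁻¹ • (μ + ν) with hm
  have h2m : (2 : ℝ≥0∞) • m = μ + ν := by
    rw [hm, smul_smul, ENNReal.mul_inv_cancel (by norm_num) (by norm_num), one_smul]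
  have : IsProbabilityMeasure m := ⟨by
    simp [hm, ENNReal.inv_two_add_inv_two]⟩
  have hmB : m.real B = (μ.real B + ν.real B) / 2 := by
    rw [hm, measureReal_ennreal_smul_apply, measureReal_add_apply]
    simp
    ring
  have hμ := sq_measureReal_sub_le_klDiv μ m (h2m ▸ Measure.le_add_right le_rfl) hB
  have hν := sq_measureReal_sub_le_klDiv ν m (h2m ▸ Measure.le_add_left le_rfl) hB
  apply Real.abs_le_sqrt
  rw [hmB] at hμ hν
  rw [jsDiv]
  nlinarith

theorem abs_measureReal_inter_fiber_sub_le {Ω α : Type*} [MeasurableSpace Ω] (ρ : Measure Ω)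
    [IsFiniteMeasure ρ] (Y V : Ω → α) (y : α) {A : Set Ω}
    (hY : MeasurableSet (A ∩ {p | Y p = y})) (hV : MeasurableSet (A ∩ {p | V p = y})) :
    |ρ.real (A ∩ {p | Y p = y}) - ρ.real (A ∩ {p | V p = y})| ≤ ρ.real {p | V p ≠ Y p} := by
  refine (abs_measureReal_sub_le_measureReal_symmDiff hY.nullMeasurableSet
    hV.nullMeasurableSet).trans (measureReal_mono ?_)
  rintro p (⟨⟨hA, h1⟩, h2⟩ | ⟨⟨hA, h1⟩, h2⟩) heq
  · exact h2 ⟨hA, heq.trans h1⟩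
  · exact h2 ⟨hA, heq.symm.trans h1⟩

section Reweighted

variable {𝒳 Z : Type*} [MeasurableSpace 𝒳] [MeasurableSpace Z] {k : ℕ}

theorem measurableSet_label (y : Fin k) : MeasurableSet {p : 𝒳 × Fin k | p.2 = y} :=
  measurable_snd (measurableSet_singleton y)

/-- The `w`-reweighted source domain on `𝒳 × Fin k`. -/
noncomputable def reweighted (DS DT : Measure (𝒳 × Fin k)) : Measure (𝒳 × Fin k) :=
  ∑ y : Fin k, ENNReal.ofReal (iw DS DT y) • DS.restrict {p | p.2 = y}

theorem reweightedFeat_eq_map (DS DT : Measure (𝒳 × Fin k)) {g : 𝒳 → Z} (hg : Measurable g) :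
    reweightedFeat DS DT g = (reweighted DS DT).map fun p => g p.1 := by
  have hm : Measurable fun p : 𝒳 × Fin k => g p.1 := hg.comp measurable_fst
  ext s hs
  simp only [reweightedFeat, reweighted, Measure.map_apply hm hs, Measure.finsetSum_apply,
    Measure.smul_apply]

instance isFiniteMeasure_reweighted (DS DT : Measure (𝒳 × Fin k)) [IsFiniteMeasure DS] :
    IsFiniteMeasure (reweighted DS DT) := ⟨by
  simp only [reweighted, Measure.finsetSum_apply, Measure.smul_apply, smul_eq_mul]
  exact ENNReal.sum_lt_top.2 fun _ _ =>
    ENNReal.mul_lt_top ENNReal.ofReal_lt_top (measure_lt_top _ _)⟩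

theorem iw_nonneg (DS DT : Measure (𝒳 × Fin k)) (y : Fin k) : 0 ≤ iw DS DT y :=
  div_nonneg ENNReal.toReal_nonneg ENNReal.toReal_nonneg

theorem reweighted_real (DS DT : Measure (𝒳 × Fin k)) [IsFiniteMeasure DS]
    (A : Set (𝒳 × Fin k)) :
    (reweighted DS DT).real A = ∑ y, iw DS DT y * DS.real (A ∩ {p | p.2 = y}) := by
  simp only [Measure.real, reweighted, Measure.finsetSum_apply, Measure.smul_apply, smul_eq_mul,
    Measure.restrict_apply' (measurableSet_label _)]
  rw [ENNReal.toReal_sum fun _ _ =>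
    (ENNReal.mul_lt_top ENNReal.ofReal_lt_top (measure_lt_top _ _)).ne]
  simp [ENNReal.toReal_mul, ENNReal.toReal_ofReal (iw_nonneg DS DT _)]

theorem sum_measureReal_inter_label (D : Measure (𝒳 × Fin k)) [IsFiniteMeasure D]
    {A : Set (𝒳 × Fin k)} : ∑ y, D.real (A ∩ {p | p.2 = y}) = D.real A := by
  have := sum_measureReal_preimage_singleton (μ := D.restrict A) (Finset.univ : Finset (Fin k))
    (f := Prod.snd) fun y _ => measurableSet_label y
  simpa [measureReal_restrict_apply (measurableSet_label _), Set.inter_comm, Set.preimage]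
    using this

theorem reweighted_real_inter_label (DS DT : Measure (𝒳 × Fin k)) [IsFiniteMeasure DS]
    (A : Set (𝒳 × Fin k)) (y : Fin k) :
    (reweighted DS DT).real (A ∩ {p | p.2 = y}) =
      iw DS DT y * DS.real (A ∩ {p | p.2 = y}) := by
  rw [reweighted_real, Finset.sum_eq_single y]
  · rw [Set.inter_assoc, Set.inter_self]
  · intro b _ hb
    have : A ∩ {p | p.2 = y} ∩ {p | p.2 = b} = ∅ := by
      ext p
      simp only [Set.mem_inter_iff, Set.mem_ofPred_eq, Set.mem_empty_iff_false, iff_false]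
      rintro ⟨⟨_, h1⟩, h2⟩
      exact hb (h2.symm.trans h1)
    simp [this]
  · simp

theorem reweighted_real_le (DS DT : Measure (𝒳 × Fin k)) [IsFiniteMeasure DS]
    (A : Set (𝒳 × Fin k)) :
    (reweighted DS DT).real A ≤ (⨆ y, iw DS DT y) * DS.real A := by
  rw [reweighted_real, ← sum_measureReal_inter_label DS (A := A), Finset.mul_sum]
  gcongr with y
  exact le_ciSup (f := fun y => iw DS DT y) (Set.finite_range _).bddAbove y

theorem isProbabilityMeasure_reweighted (DS DT : Measure (𝒳 × Fin k)) [IsFiniteMeasure DS]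
    [IsProbabilityMeasure DT] (hS : ∀ y : Fin k, 0 < DS {p | p.2 = y}) :
    IsProbabilityMeasure (reweighted DS DT) := by
  rw [isProbabilityMeasure_iff_real, reweighted_real]
  rw [← probReal_univ (μ := DT), ← sum_measureReal_inter_label DT]
  refine Finset.sum_congr rfl fun y _ => ?_
  rw [Set.univ_inter]
  exact div_mul_cancel₀ _ (ENNReal.toReal_pos (hS y).ne' (measure_ne_top _ _)).ne'

theorem condFeat_apply_toReal (D : Measure (𝒳 × Fin k)) {g : 𝒳 → Z} (hg : Measurable g)
    (y : Fin k) {E : Set Z} (hE : MeasurableSet E) :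
    (condFeat D g y E).toReal =
      D.real ((fun p => g p.1) ⁻¹' E ∩ {p | p.2 = y}) / D.real {p | p.2 = y} := by
  have hm : Measurable fun p : 𝒳 × Fin k => g p.1 := hg.comp measurable_fst
  rw [condFeat, Measure.smul_apply, Measure.map_apply hm hE,
    Measure.restrict_apply (hm hE), smul_eq_mul, ENNReal.toReal_mul, ENNReal.toReal_inv,
    Measure.real, Measure.real, div_eq_inv_mul]

end Reweighted

/-- Bound on the conditional feature-distribution discrepancy in terms of the errors and the
JSD between the reweighted source and target feature distributions. -/
theorem conditional_tv_bound_js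
    {𝒳 Z : Type*} [MeasurableSpace 𝒳] [MeasurableSpace Z] {k : ℕ} (hk : 2 ≤ k)
    (DS DT : Measure (𝒳 × Fin k)) [IsProbabilityMeasure DS] [IsProbabilityMeasure DT]
    (hS : ∀ y : Fin k, 0 < DS {p | p.2 = y}) (hT : ∀ y : Fin k, 0 < DT {p | p.2 = y})
    (g : 𝒳 → Z) (hg : Measurable g) (h : Z → Fin k) (hh : Measurable h) :
    (⨆ y : Fin k, tvDist (condFeat DS g y) (condFeat DT g y)) ≤
      ((⨆ y : Fin k, iw DS DT y) * err DS (h ∘ g) + err DT (h ∘ g) +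
          Real.sqrt (8 * jsDiv (reweightedFeat DS DT g) (featMeasure DT g))) /
        (⨅ y : Fin k, (DT {p | p.2 = y}).toReal) := by
  have : Nonempty (Fin k) := ⟨⟨0, by omega⟩⟩
  have hm : Measurable fun p : 𝒳 × Fin k => g p.1 := hg.comp measurable_fst
  have := isProbabilityMeasure_reweighted DS DT hS
  have : IsProbabilityMeasure (reweightedFeat DS DT g) := by
    rw [reweightedFeat_eq_map DS DT hg]
    exact Measure.isProbabilityMeasure_map hm.aemeasurable
  have : IsProbabilityMeasure (featMeasure DT g) :=
    Measure.isProbabilityMeasure_map hm.aemeasurable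
  have hTpos : ∀ y : Fin k, 0 < (DT {p | p.2 = y}).toReal := fun y =>
    ENNReal.toReal_pos (hT y).ne' (measure_ne_top _ _)
  obtain ⟨y₀, hy₀⟩ := exists_eq_ciInf_of_finite (f := fun y : Fin k => (DT {p | p.2 = y}).toReal)
  have hγ : 0 < ⨅ y : Fin k, (DT {p | p.2 = y}).toReal := hy₀ ▸ hTpos y₀
  have hnum : ∀ (y : Fin k) (E : Set Z), MeasurableSet E →
      |iw DS DT y * DS.real ((fun p => g p.1) ⁻¹' E ∩ {p | p.2 = y})
        - DT.real ((fun p => g p.1) ⁻¹' E ∩ {p | p.2 = y})| ≤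
      (⨆ y : Fin k, iw DS DT y) * err DS (h ∘ g) + err DT (h ∘ g) +
        √(8 * jsDiv (reweightedFeat DS DT g) (featMeasure DT g)) := by
    intro y E hE
    have hB : MeasurableSet (E ∩ h ⁻¹' {y}) := hE.inter (hh (measurableSet_singleton y))
    have hY := (hm hE).inter (measurableSet_label (𝒳 := 𝒳) y)
    have hV : MeasurableSet ((fun p : 𝒳 × Fin k => g p.1) ⁻¹' E ∩ {p | h (g p.1) = y}) := hm hB
    have h1 := abs_measureReal_inter_fiber_sub_le (reweighted DS DT) Prod.snd _ y hY hV
    have h2 := abs_measureReal_inter_fiber_sub_le DT Prod.snd _ y hY hV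
    have h3 := abs_measureReal_sub_le_sqrt_jsDiv (reweightedFeat DS DT g) (featMeasure DT g) hB
    have h4 := h1.trans (reweighted_real_le DS DT _)
    rw [reweighted_real_inter_label] at h4
    have hS' : (reweightedFeat DS DT g).real (E ∩ h ⁻¹' {y}) =
        (reweighted DS DT).real ((fun p => g p.1) ⁻¹' E ∩ {p | h (g p.1) = y}) := by
      rw [reweightedFeat_eq_map DS DT hg, map_measureReal_apply hm hB]
      rfl
    have hT' : (featMeasure DT g).real (E ∩ h ⁻¹' {y}) =
        DT.real ((fun p => g p.1) ⁻¹' E ∩ {p | h (g p.1) = y}) := by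
      rw [featMeasure, map_measureReal_apply hm hB]
      rfl
    rw [hS', hT'] at h3
    change _ ≤ _ * err DS (h ∘ g) at h4
    change _ ≤ err DT (h ∘ g) at h2
    rw [abs_le] at *
    constructor <;> linarith
  have : Nonempty {s : Set Z // MeasurableSet s} := ⟨⟨∅, MeasurableSet.empty⟩⟩
  refine ciSup_le fun y => ciSup_le fun ⟨E, hE⟩ => ?_
  have hSpos : 0 < DS.real {p | p.2 = y} := ENNReal.toReal_pos (hS y).ne' (measure_ne_top _ _)
  have hTy : 0 < DT.real {p | p.2 = y} := hTpos y
  have hdiff : (condFeat DS g y E).toReal - (condFeat DT g y E).toReal =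
      (iw DS DT y * DS.real ((fun p => g p.1) ⁻¹' E ∩ {p | p.2 = y})
        - DT.real ((fun p => g p.1) ⁻¹' E ∩ {p | p.2 = y})) / DT.real {p | p.2 = y} := by
    rw [condFeat_apply_toReal DS hg y hE, condFeat_apply_toReal DT hg y hE,
      show iw DS DT y = DT.real {p | p.2 = y} / DS.real {p | p.2 = y} from rfl]
    field_simp
  have hE' := hnum y E hE
  simp only [hdiff, abs_div, abs_of_pos hTy]
  exact div_le_div₀ ((abs_nonneg _).trans hE') hE' hγ
    (ciInf_le (Set.finite_range _).bddBelow y)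
end

section
/- Let D_S, D_T be domains on 𝒳 × 𝒴, let Ŷ be a measurable classifier, and set γ_{a,j} := D_a(Y = j) for a ∈ {S,T} and j ∈ 𝒴 (assumed positive). Then for all α_j, β_j ≥ 0 with α_j + β_j = 1 and for all i ≠ j in 𝒴: |γ_{S,j}·D_S(Ŷ = i | Y = j) − γ_{T,j}·D_T(Ŷ = i | Y = j)| ≤ |γ_{S,j} − γ_{T,j}|·(α_j·D_S(Ŷ = i | Y = j) + β_j·D_T(Ŷ = i | Y = j)) + γ_{S,j}·β_j·Δ_CE(Ŷ) + γ_{T,j}·α_j·Δ_CE(Ŷ). -/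
open MeasureTheory Real
open scoped ENNReal

/-- Conditional probability of the event `A` given `Y = y` under the domain `D`. -/
noncomputable def condProb {𝒳 : Type*} [MeasurableSpace 𝒳] {k : ℕ}
    (D : Measure (𝒳 × Fin k)) (A : Set (𝒳 × Fin k)) (y : Fin k) : ℝ :=
  (D (A ∩ {p | p.2 = y})).toReal / (D {p | p.2 = y}).toReal

/-- Conditional error gap `Δ_CE(Ŷ) = max_{y ≠ y'} |D_S(Ŷ = y' | Y = y) − D_T(Ŷ = y' | Y = y)|`. -/
noncomputable def condErrGap {𝒳 : Type*} [MeasurableSpace 𝒳] {k : ℕ}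
    (DS DT : Measure (𝒳 × Fin k)) (f : 𝒳 → Fin k) : ℝ :=
  ⨆ q : {q : Fin k × Fin k // q.1 ≠ q.2},
    |condProb DS {p | f p.1 = q.1.2} q.1.1 - condProb DT {p | f p.1 = q.1.2} q.1.1|

theorem condProb_nonneg {𝒳 : Type*} [MeasurableSpace 𝒳] {k : ℕ}
    (D : Measure (𝒳 × Fin k)) (A : Set (𝒳 × Fin k)) (y : Fin k) : 0 ≤ condProb D A y :=
  div_nonneg ENNReal.toReal_nonneg ENNReal.toReal_nonneg

theorem abs_condProb_sub_le_condErrGap {𝒳 : Type*} [MeasurableSpace 𝒳] {k : ℕ}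
    (DS DT : Measure (𝒳 × Fin k)) (f : 𝒳 → Fin k) {i j : Fin k} (hij : i ≠ j) :
    |condProb DS {p | f p.1 = i} j - condProb DT {p | f p.1 = i} j| ≤ condErrGap DS DT f :=
  le_ciSup (f := fun q : {q : Fin k × Fin k // q.1 ≠ q.2} =>
    |condProb DS {p | f p.1 = q.1.2} q.1.1 - condProb DT {p | f p.1 = q.1.2} q.1.1|)
    (Set.finite_range _).bddAbove ⟨(j, i), hij.symm⟩

/-- A difference of products is controlled by the differences of the factors, with any convex
weights `α`, `β`. -/
theorem abs_mul_sub_mul_le {s t a b α β Δ : ℝ} (hs : 0 ≤ s) (ht : 0 ≤ t) (ha : 0 ≤ a)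
    (hb : 0 ≤ b) (hα : 0 ≤ α) (hβ : 0 ≤ β) (hαβ : α + β = 1) (hΔ : |a - b| ≤ Δ) :
    |s * a - t * b| ≤ |s - t| * (α * a + β * b) + s * β * Δ + t * α * Δ := by
  have key : s * a - t * b =
      (s - t) * (α * a + β * b) + s * β * (a - b) + t * α * (a - b) := by
    linear_combination (t * b - s * a) * hαβ
  rw [key]
  refine (abs_add_three _ _ _).trans ?_
  rw [abs_mul, abs_mul (s * β), abs_mul (t * α), abs_of_nonneg (mul_nonneg hs hβ),
    abs_of_nonneg (mul_nonneg ht hα), abs_of_nonneg (by positivity : 0 ≤ α * a + β * b)]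
  gcongr

/-- Key intermediate inequality in the error decomposition theorem. -/
theorem mixture_conditional_bound
    {𝒳 : Type*} [MeasurableSpace 𝒳] {k : ℕ} (hk : 2 ≤ k)
    (DS DT : Measure (𝒳 × Fin k)) [IsProbabilityMeasure DS] [IsProbabilityMeasure DT]
    (hS : ∀ j : Fin k, 0 < DS {p | p.2 = j}) (hT : ∀ j : Fin k, 0 < DT {p | p.2 = j})
    (f : 𝒳 → Fin k) (hf : Measurable f)
    (i j : Fin k) (hij : i ≠ j)
    (α β : ℝ) (hα : 0 ≤ α) (hβ : 0 ≤ β) (hαβ : α + β = 1) :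
    |(DS {p | p.2 = j}).toReal * condProb DS {p | f p.1 = i} j -
        (DT {p | p.2 = j}).toReal * condProb DT {p | f p.1 = i} j| ≤
      |(DS {p | p.2 = j}).toReal - (DT {p | p.2 = j}).toReal| *
          (α * condProb DS {p | f p.1 = i} j + β * condProb DT {p | f p.1 = i} j) +
        (DS {p | p.2 = j}).toReal * β * condErrGap DS DT f +
        (DT {p | p.2 = j}).toReal * α * condErrGap DS DT f :=
  abs_mul_sub_mul_le ENNReal.toReal_nonneg ENNReal.toReal_nonneg (condProb_nonneg _ _ _)
    (condProb_nonneg _ _ _) hα hβ hαβ (abs_condProb_sub_le_condErrGap DS DT f hij)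
end
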